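/- arXiv:2001.04150 — 2 statements merged into one kernel-verified Lean document; each statement's English description precedes it below -/
import Mathlib

section
/- Let α ≥ 2, h, ℓ, t ≥ 1, ε ≥ 0, and suppose r ≤ β · q^{f(t)/(α-1)}, where β = ((α-1)!/(2eγα))^{1/(α-1)}, γ = 4, and f(t) = (αℓ+ε-h)εt² + (αℓ+2ε-h)t + 1 with αℓ + ε ≥ h. Then there exist matrices A_1, …, A_r ∈ F_q^{ℓt × ht} such that for every α-subset {i_1, …, i_α} ⊆ {1, …, r}, the vertical concatenation of A_{i_1}, …, A_{i_α} has rank at least (h-ε)t. -/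
section LocalLemma

variable {ι X : Type*} [Fintype ι] [DecidableEq ι] [Fintype X]

open Classical in
theorem card_filter_and_mul_card (S : Finset ι) (P Q : (ι → X) → Prop)
    (hP : ∀ f g, (∀ i ∈ S, f i = g i) → P f → P g)
    (hQ : ∀ f g, (∀ i ∉ S, f i = g i) → Q f → Q g) :
    (Finset.univ.filter fun f => P f ∧ Q f).card * Fintype.card (ι → X) =
      (Finset.univ.filter P).card * (Finset.univ.filter Q).card := by
  rw [← Finset.card_univ, ← Finset.card_product, ← Finset.card_product]
  let φ : (ι → X) × (ι → X) → (ι → X) × (ι → X) :=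
    fun p => (S.piecewise p.1 p.2, S.piecewise p.2 p.1)
  have hφ : ∀ p, φ (φ p) = p := by
    rintro ⟨f, g⟩
    ext i <;> by_cases hi : i ∈ S <;> simp [φ, hi]
  refine Finset.card_nbij' φ φ ?_ ?_ (fun p _ => hφ p) (fun p _ => hφ p)
  · rintro ⟨f, g⟩ h
    simp only [Finset.coe_product, Set.mem_prod, Finset.mem_coe, Finset.mem_filter,
      Finset.mem_univ, true_and, and_true] at h ⊢
    exact ⟨hP f _ (fun i hi => by simp [φ, hi]) h.1, hQ f _ (fun i hi => by simp [φ, hi]) h.2⟩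
  · rintro ⟨f, g⟩ h
    simp only [Finset.coe_product, Set.mem_prod, Finset.mem_coe, Finset.mem_filter,
      Finset.mem_univ, true_and, and_true] at h ⊢
    exact ⟨hP f _ (fun i hi => by simp [φ, hi]) h.1, hQ g _ (fun i hi => by simp [φ, hi]) h.2⟩

theorem card_filter_mem_subset_insert_le (v : ι) (V : Finset ι) (k : ℕ) :
    (Finset.univ.filter fun I : Finset ι => I.card = k + 1 ∧ v ∈ I ∧ I ⊆ insert v V).card ≤
      (Fintype.card ι - 1).choose k := by
  rw [← Finset.card_univ, ← Finset.card_erase_of_mem (Finset.mem_univ v),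
    ← Finset.card_powersetCard]
  refine Finset.card_le_card_of_injOn (fun I => I.erase v) ?_ ?_
  · intro I hI
    simp only [Finset.mem_coe, Finset.mem_filter, Finset.mem_univ, true_and] at hI
    simp only [Finset.mem_coe, Finset.mem_powersetCard]
    exact ⟨Finset.erase_subset_erase v (Finset.subset_univ I), by
      rw [Finset.card_erase_of_mem hI.2.1, hI.1]; rfl⟩
  · intro I hI J hJ h
    simp only [Finset.mem_coe, Finset.mem_filter, Finset.mem_univ, true_and] at hI hJ
    rw [← Finset.insert_erase hI.2.1, ← Finset.insert_erase hJ.2.1]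
    exact congrArg (insert v) h

/-- No bad event indexed by a `(k + 1)`-subset of `V` occurs at `f`. -/
def Avoids (bad : Finset ι → (ι → X) → Prop) (k : ℕ) (V : Finset ι) (f : ι → X) : Prop :=
  ∀ I ⊆ V, I.card = k + 1 → ¬ bad I f

open Classical in
/-- The number of `f` for which no bad event indexed by a `(k + 1)`-subset of `V` occurs. -/
noncomputable def goodCount (bad : Finset ι → (ι → X) → Prop) (k : ℕ) (V : Finset ι) : ℕ :=
  (Finset.univ.filter (Avoids bad k V)).card

variable {bad : Finset ι → (ι → X) → Prop} {k : ℕ}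

theorem pow_mul_goodCount_le {c : ℝ} (hc : 0 ≤ c) {V : Finset ι}
    (h : ∀ U ⊂ V, ∀ v ∉ U, c * goodCount bad k U ≤ goodCount bad k (insert v U))
    {W T : Finset ι} (hWT : Disjoint W T) (hV : W ∪ T = V) :
    c ^ T.card * goodCount bad k W ≤ goodCount bad k V := by
  subst hV
  induction T using Finset.induction_on with
  | empty => simp
  | insert v T hv ih =>
    rw [Finset.disjoint_insert_right] at hWT
    have hvWT : v ∉ W ∪ T := by simp [hWT.1, hv]
    have hss : W ∪ T ⊂ W ∪ insert v T := by
      rw [Finset.union_insert]; exact Finset.ssubset_insert hvWT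
    rw [Finset.card_insert_of_notMem hv, pow_succ', mul_assoc]
    calc _ ≤ c * goodCount bad k (W ∪ T) := by
          gcongr
          exact ih hWT.2 (fun U hU => h U (hU.trans hss))
      _ ≤ _ := by
          rw [Finset.union_insert]
          exact h _ hss v hvWT

open Classical in
theorem card_bad_and_avoids_le [Nonempty X] {c b : ℝ} (hc : 0 < c)
    (hdep : ∀ I f g, (∀ i ∈ I, f i = g i) → bad I f → bad I g)
    (hbad : ∀ I : Finset ι, I.card = k + 1 → ((Finset.univ.filter (bad I)).card : ℝ) ≤ b)
    {V : Finset ι}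
    (h : ∀ U ⊂ V, ∀ v ∉ U, c * goodCount bad k U ≤ goodCount bad k (insert v U))
    {v : ι} (hv : v ∉ V) {I : Finset ι} (hIc : I.card = k + 1) (hvI : v ∈ I)
    (hIV : I ⊆ insert v V) :
    ((Finset.univ.filter fun f => bad I f ∧ Avoids bad k (V \ I) f).card : ℝ) ≤
      b * goodCount bad k V / (c ^ k * Fintype.card (ι → X)) := by
  have hΩ : (0 : ℝ) < Fintype.card (ι → X) := by exact_mod_cast Fintype.card_pos
  have hind := card_filter_and_mul_card I (bad I) (Avoids bad k (V \ I)) (hdep I) (by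
    intro f g hfg hf J hJ hJc hJb
    refine hf J hJ hJc (hdep J g f (fun i hi => (hfg i ?_).symm) hJb)
    exact (Finset.mem_sdiff.1 (hJ hi)).2)
  have hpow := pow_mul_goodCount_le hc.le h (W := V \ I) (T := I.erase v)
    (Finset.sdiff_disjoint.mono_right (Finset.erase_subset v I))
    (by
      ext i
      have := @hIV i
      simp only [Finset.mem_insert] at this
      simp only [Finset.mem_union, Finset.mem_sdiff, Finset.mem_erase]
      grind)
  rw [Finset.card_erase_of_mem hvI, hIc, Nat.add_sub_cancel] at hpow
  rw [le_div_iff₀ (by positivity)]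
  set N := (Finset.univ.filter fun f => bad I f ∧ Avoids bad k (V \ I) f).card
  have hind' : (N : ℝ) * Fintype.card (ι → X) =
      (Finset.univ.filter (bad I)).card * goodCount bad k (V \ I) := by exact_mod_cast hind
  calc (N : ℝ) * (c ^ k * Fintype.card (ι → X))
      = c ^ k * (N * Fintype.card (ι → X)) := by ring
    _ = (Finset.univ.filter (bad I)).card * (c ^ k * goodCount bad k (V \ I)) := by
        rw [hind']; ring
    _ ≤ b * goodCount bad k V := mul_le_mul (hbad I hIc) hpow (by positivity)
        ((Nat.cast_nonneg _).trans (hbad I hIc))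

open Classical in
theorem filter_avoids_subset (bad : Finset ι → (ι → X) → Prop) (k : ℕ) (V : Finset ι) (v : ι) :
    Finset.univ.filter (Avoids bad k V) ⊆ Finset.univ.filter (Avoids bad k (insert v V)) ∪
      (Finset.univ.filter fun I : Finset ι => I.card = k + 1 ∧ v ∈ I ∧ I ⊆ insert v V).biUnion
        fun I => Finset.univ.filter fun f => bad I f ∧ Avoids bad k (V \ I) f := by
  intro f hf
  rw [Finset.mem_filter] at hf
  rw [Finset.mem_union, or_iff_not_imp_left]
  intro hnot
  simp only [Avoids, Finset.mem_filter, Finset.mem_univ, true_and, not_forall,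
    not_not] at hnot
  obtain ⟨I, hI, hIc, hIb⟩ := hnot
  have hvI : v ∈ I := by
    by_contra hvI
    exact hf.2 I ((Finset.subset_insert_iff_of_notMem hvI).1 hI) hIc hIb
  rw [Finset.mem_biUnion]
  refine ⟨I, by simp [hIc, hvI, hI], ?_⟩
  simp only [Finset.mem_filter, Finset.mem_univ, true_and]
  exact ⟨hIb, fun J hJ => hf.2 J (hJ.trans Finset.sdiff_subset)⟩

open Classical in
theorem mul_goodCount_le_insert [Nonempty X] {c b : ℝ} (hc : 0 < c) (hb : 0 ≤ b)
    (hdep : ∀ I f g, (∀ i ∈ I, f i = g i) → bad I f → bad I g)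
    (hbad : ∀ I : Finset ι, I.card = k + 1 → ((Finset.univ.filter (bad I)).card : ℝ) ≤ b)
    (hcond : ((Fintype.card ι - 1).choose k : ℝ) * b ≤
      (1 - c) * c ^ k * Fintype.card (ι → X))
    (V : Finset ι) : ∀ v ∉ V, c * goodCount bad k V ≤ goodCount bad k (insert v V) := by
  induction V using Finset.strongInduction with
  | H V ih =>
  intro v hv
  have hΩ : (0 : ℝ) < Fintype.card (ι → X) := by exact_mod_cast Fintype.card_pos
  set E := Finset.univ.filter fun I : Finset ι => I.card = k + 1 ∧ v ∈ I ∧ I ⊆ insert v V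
    with hE
  set n : Finset ι → ℕ := fun I =>
    (Finset.univ.filter fun f => bad I f ∧ Avoids bad k (V \ I) f).card with hn
  have hterm : ∀ I ∈ E, (n I : ℝ) ≤ b * goodCount bad k V / (c ^ k * Fintype.card (ι → X)) := by
    intro I hI
    simp only [hE, Finset.mem_filter, Finset.mem_univ, true_and] at hI
    exact card_bad_and_avoids_le hc hdep hbad ih hv hI.1 hI.2.1 hI.2.2
  have hunion : goodCount bad k V ≤ goodCount bad k (insert v V) + ∑ I ∈ E, n I :=
    (Finset.card_le_card (filter_avoids_subset bad k V v)).trans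
      ((Finset.card_union_le _ _).trans (Nat.add_le_add_left Finset.card_biUnion_le _))
  have hsum : (∑ I ∈ E, (n I : ℝ)) ≤
      E.card * (b * goodCount bad k V / (c ^ k * Fintype.card (ι → X))) := by
    rw [← nsmul_eq_mul]
    exact Finset.sum_le_card_nsmul _ _ _ hterm
  have hEc : (E.card : ℝ) ≤ (Fintype.card ι - 1).choose k := by
    exact_mod_cast card_filter_mem_subset_insert_le v V k
  have hlast : E.card * (b * goodCount bad k V / (c ^ k * Fintype.card (ι → X))) ≤
      (1 - c) * goodCount bad k V := by
    rw [← mul_div_assoc, div_le_iff₀ (by positivity)]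
    calc _ ≤ (((Fintype.card ι - 1).choose k : ℝ) * b) * goodCount bad k V := by
          rw [← mul_assoc]; gcongr
      _ ≤ ((1 - c) * c ^ k * Fintype.card (ι → X)) * goodCount bad k V := by gcongr
      _ = _ := by ring
  have hunion' : (goodCount bad k V : ℝ) ≤ goodCount bad k (insert v V) + ∑ I ∈ E, (n I : ℝ) := by
    exact_mod_cast hunion
  linarith

theorem inv_exp_one_le_pow (k : ℕ) : (Real.exp 1)⁻¹ ≤ (1 - 1 / ((k : ℝ) + 1)) ^ k := by
  rcases k.eq_zero_or_pos with rfl | hk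
  · simpa using inv_le_one_of_one_le₀ (Real.one_le_exp zero_le_one)
  have hk' : (0 : ℝ) < k := by exact_mod_cast hk
  have h1 : 1 + 1 / (k : ℝ) ≤ Real.exp (1 / k) := by
    rw [add_comm]; exact Real.add_one_le_exp _
  have h2 : (1 + 1 / (k : ℝ)) ^ k ≤ Real.exp 1 := by
    calc _ ≤ Real.exp (1 / k) ^ k := by gcongr
      _ = _ := by rw [← Real.exp_nat_mul]; congr 1; field_simp
  have h3 : 1 - 1 / ((k : ℝ) + 1) = (1 + 1 / (k : ℝ))⁻¹ := by field_simp; ring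
  rw [h3, inv_pow]
  exact inv_anti₀ (by positivity) h2

open Classical in
/-- A symmetric Lovász local lemma for bad events indexed by the subsets of size `k + 1`
of a family of independent uniform variables. -/
theorem exists_forall_not_bad [Nonempty X] {b : ℝ} (hk : 1 ≤ k) (hb : 0 ≤ b)
    (hdep : ∀ I f g, (∀ i ∈ I, f i = g i) → bad I f → bad I g)
    (hbad : ∀ I : Finset ι, I.card = k + 1 → ((Finset.univ.filter (bad I)).card : ℝ) ≤ b)
    (hcond : Real.exp 1 * (k + 1) * (Fintype.card ι - 1).choose k * b ≤
      Fintype.card (ι → X)) :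
    ∃ f, ∀ I : Finset ι, I.card = k + 1 → ¬ bad I f := by
  have hk' : (1 : ℝ) ≤ k := by exact_mod_cast hk
  set c : ℝ := 1 - 1 / ((k : ℝ) + 1) with hc
  have hc0 : 0 < c := by
    have : c = k / (k + 1) := by rw [hc]; field_simp; ring
    rw [this]; positivity
  have hstep := mul_goodCount_le_insert hc0 hb hdep hbad (by
    calc ((Fintype.card ι - 1).choose k : ℝ) * b =
        (1 / ((k : ℝ) + 1)) * (Real.exp 1)⁻¹ *
          (Real.exp 1 * (k + 1) * (Fintype.card ι - 1).choose k * b) := by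
          field_simp
      _ ≤ (1 / ((k : ℝ) + 1)) * c ^ k * Fintype.card (ι → X) := by
          gcongr
          exact inv_exp_one_le_pow k
      _ = (1 - c) * c ^ k * Fintype.card (ι → X) := by rw [hc]; ring)
  have h := pow_mul_goodCount_le hc0.le (V := Finset.univ) (fun U _ => hstep U)
    (W := ∅) (T := Finset.univ) (Finset.disjoint_empty_left _) (by simp)
  have h0 : 0 < goodCount bad k (∅ : Finset ι) := by
    refine Finset.card_pos.2 ⟨fun _ => Classical.arbitrary X, ?_⟩
    rw [Finset.mem_filter]
    exact ⟨Finset.mem_univ _, fun I hI hIc => by simp [Finset.subset_empty.1 hI] at hIc⟩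
  have h1 : 0 < goodCount bad k (Finset.univ : Finset ι) := by
    have : (0 : ℝ) < goodCount bad k (Finset.univ : Finset ι) :=
      lt_of_lt_of_le (by positivity) h
    exact_mod_cast this
  obtain ⟨f, hf⟩ := Finset.card_pos.1 h1
  exact ⟨f, fun I => (Finset.mem_filter.1 hf).2 I (Finset.subset_univ I)⟩

end LocalLemma

section RankCount

theorem pow_mul_self_le_four_mul_prod {q : ℕ} (hq : 2 ≤ q) (ρ : ℕ) :
    q ^ (ρ * ρ) ≤ 4 * ∏ i : Fin ρ, (q ^ ρ - q ^ (i : ℕ)) := by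
  rcases ρ.eq_zero_or_pos with rfl | hρ
  · simp
  suffices h : (q : ℤ) ^ (ρ * ρ) * (q ^ ρ + 2) ≤
      4 * (∏ i : Fin ρ, ((q : ℤ) ^ ρ - q ^ (i : ℕ))) * q ^ ρ by
    have hcast : ((∏ i : Fin ρ, (q ^ ρ - q ^ (i : ℕ)) : ℕ) : ℤ) =
        ∏ i : Fin ρ, ((q : ℤ) ^ ρ - q ^ (i : ℕ)) := by
      rw [Nat.cast_prod]
      refine Finset.prod_congr rfl fun i _ => ?_
      rw [Nat.cast_sub (Nat.pow_le_pow_right (by omega) i.2.le)]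
      push_cast
      rfl
    have hpos : (0 : ℤ) < q ^ ρ := by positivity
    zify
    rw [← Nat.cast_prod, hcast]
    refine le_of_mul_le_mul_right (le_trans ?_ h) hpos
    exact mul_le_mul_of_nonneg_left (by omega) (by positivity)
  have hq' : (2 : ℤ) ≤ q := by exact_mod_cast hq
  induction ρ, hρ using Nat.le_induction with
  | base => simp; nlinarith
  | succ ρ hρ ih =>
    have hprod : ∏ i : Fin (ρ + 1), ((q : ℤ) ^ (ρ + 1) - q ^ (i : ℕ)) =
        (q ^ (ρ + 1) - 1) * (q ^ ρ * ∏ i : Fin ρ, ((q : ℤ) ^ ρ - q ^ (i : ℕ))) := by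
      rw [Fin.prod_univ_succ, Fin.val_zero, pow_zero]
      congr 1
      have h : (q : ℤ) ^ ρ = ∏ _i : Fin ρ, (q : ℤ) := (Fin.prod_const ρ (q : ℤ)).symm
      rw [h, ← Finset.prod_mul_distrib, ← h]
      refine Finset.prod_congr rfl fun i _ => ?_
      rw [Fin.val_succ]
      ring
    rw [hprod]
    have hy : (2 : ℤ) ≤ (q : ℤ) ^ ρ := by
      calc (2 : ℤ) ≤ q := hq'
        _ = (q : ℤ) ^ 1 := (pow_one _).symm
        _ ≤ (q : ℤ) ^ ρ := pow_le_pow_right₀ (by omega) hρ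
    have hexp : (ρ + 1) * (ρ + 1) = ρ * ρ + (ρ + (ρ + 1)) := by ring
    rw [hexp, pow_add, pow_add]
    set P := ∏ i : Fin ρ, ((q : ℤ) ^ ρ - q ^ (i : ℕ))
    set y := (q : ℤ) ^ ρ
    set Z := (q : ℤ) ^ (ρ * ρ)
    have hs : (q : ℤ) ^ (ρ + 1) = q * y := by rw [pow_succ']
    have hZ : 0 < Z := by positivity
    rw [hs]
    calc Z * (y * (q * y)) * (q * y + 2) = (y * q * Z) * (y * (q * y + 2)) := by ring
      _ ≤ (y * q * Z) * ((y + 2) * (q * y - 1)) := by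
          refine mul_le_mul_of_nonneg_left ?_ (by positivity)
          nlinarith
      _ = (y * q * (q * y - 1)) * (Z * (y + 2)) := by ring
      _ ≤ (y * q * (q * y - 1)) * (4 * P * y) := by
          refine mul_le_mul_of_nonneg_left ih ?_
          have : 0 ≤ (q : ℤ) * y - 1 := by nlinarith
          positivity
      _ = _ := by ring

variable {K V : Type*} [Field K] [AddCommGroup V] [Module K V]

theorem Submodule.exists_le_finrank_eq [FiniteDimensional K V] (U : Submodule K V) {d : ℕ}
    (hU : Module.finrank K U ≤ d) (hd : d ≤ Module.finrank K V) :
    ∃ W : Submodule K V, U ≤ W ∧ Module.finrank K W = d := by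
  induction d, hU using Nat.le_induction with
  | base => exact ⟨U, le_rfl, rfl⟩
  | succ d _ ih =>
    obtain ⟨W, hUW, hW⟩ := ih (by omega)
    have hne : W ≠ ⊤ := by
      rintro rfl
      rw [finrank_top] at hW
      omega
    obtain ⟨v, -, hv⟩ := SetLike.exists_of_lt (lt_top_iff_ne_top.2 hne)
    exact ⟨W ⊔ Submodule.span K {v}, hUW.trans le_sup_left, by
      rw [Submodule.finrank_sup_span_singleton hv, hW]⟩

variable [Fintype K]

open Classical in
theorem prod_le_card_linearIndependent_le_span [Fintype V] (W : Submodule K V) {ρ : ℕ}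
    (hW : Module.finrank K W = ρ) :
    ∏ i : Fin ρ, (Fintype.card K ^ ρ - Fintype.card K ^ (i : ℕ)) ≤
      (Finset.univ.filter fun s : Fin ρ → V =>
        LinearIndependent K s ∧ W ≤ Submodule.span K (Set.range s)).card := by
  have h := card_linearIndependent (K := K) (V := W) (k := ρ) hW.ge
  rw [hW] at h
  rw [← h, ← Fintype.card_subtype, ← Nat.card_eq_fintype_card]
  refine Nat.card_le_card_of_injective
    (fun s => ⟨fun i => (s.1 i : V), s.2.map' W.subtype W.ker_subtype, ?_⟩) ?_
  · have hs := s.2.span_eq_top_of_card_eq_finrank' (by simp [hW])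
    have h2 := congrArg (Submodule.map W.subtype) hs
    rw [Submodule.map_span, Submodule.map_top, Submodule.range_subtype, ← Set.range_comp] at h2
    exact h2.ge
  · intro s s' hss
    ext i
    exact congrFun (congrArg Subtype.val hss) i

variable {ι m n : Type*} [Fintype ι] [DecidableEq ι] [Fintype m] [DecidableEq m]
  [Fintype n] [DecidableEq n]

open Classical in
theorem card_matrix_range_vecMulLinear_le (W : Submodule K (n → K)) :
    (Finset.univ.filter fun A : Matrix m n K => LinearMap.range A.vecMulLinear ≤ W).card =
      Fintype.card K ^ (Module.finrank K W * Fintype.card m) := by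
  have h : (Finset.univ.filter fun A : Matrix m n K => LinearMap.range A.vecMulLinear ≤ W).card =
      (Fintype.piFinset fun _ : m => Finset.univ.filter (· ∈ W)).card := by
    refine Finset.card_equiv Matrix.of.symm fun A => ?_
    rw [Finset.mem_filter, range_vecMulLinear, Submodule.span_le, Set.range_subset_iff,
      Fintype.mem_piFinset]
    simp only [Finset.mem_filter, Finset.mem_univ, true_and]
    exact Iff.rfl
  rw [h, Fintype.card_piFinset, Finset.prod_const, Finset.card_univ, ← Fintype.card_subtype,
    pow_mul]
  congr 1
  exact Module.card_eq_pow_finrank (K := K) (V := W)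

open Classical in
theorem card_forall_range_le_mul_pow (I : Finset ι) (W : Submodule K (n → K)) {u : ℕ}
    (hu : Fintype.card n = Module.finrank K W + u) :
    (Finset.univ.filter fun A : ι → Matrix m n K =>
        ∀ i ∈ I, LinearMap.range (A i).vecMulLinear ≤ W).card *
      Fintype.card K ^ (u * (I.card * Fintype.card m)) =
      Fintype.card (ι → Matrix m n K) := by
  have h : (Finset.univ.filter fun A : ι → Matrix m n K =>
        ∀ i ∈ I, LinearMap.range (A i).vecMulLinear ≤ W) =
      Fintype.piFinset fun i => if i ∈ I then
        Finset.univ.filter fun A : Matrix m n K => LinearMap.range A.vecMulLinear ≤ W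
        else Finset.univ := by
    ext A
    simp only [Finset.mem_filter, Finset.mem_univ, true_and, Fintype.mem_piFinset]
    refine forall_congr' fun i => ?_
    split_ifs with hi <;> simp [hi]
  have hM : Fintype.card (Matrix m n K) =
      Fintype.card K ^ (Module.finrank K W * Fintype.card m) *
        Fintype.card K ^ (u * Fintype.card m) := by
    rw [← pow_add, ← add_mul, ← hu, Module.card_eq_pow_finrank (K := K) (V := Matrix m n K),
      Module.finrank_matrix, Module.finrank_self, mul_one, mul_comm]
  have hpow : Fintype.card K ^ (u * (I.card * Fintype.card m)) =
      ∏ i : ι, if i ∈ I then Fintype.card K ^ (u * Fintype.card m) else 1 := by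
    rw [Finset.prod_ite_mem, Finset.univ_inter, Finset.prod_const, ← pow_mul]
    congr 1
    ring
  rw [h, Fintype.card_piFinset, hpow, ← Finset.prod_mul_distrib, Fintype.card_fun]
  rw [← Finset.card_univ (α := ι), ← Finset.prod_const]
  refine Finset.prod_congr rfl fun i _ => ?_
  split_ifs with hi
  · rw [card_matrix_range_vecMulLinear_le, hM]
  · rw [mul_one, Finset.card_univ]

open Classical in
theorem card_finrank_iSup_le_mul_pow_le (I : Finset ι) {ρ u w : ℕ}
    (hu : Fintype.card n = ρ + u) (hw : I.card * Fintype.card m = ρ + w) :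
    (Finset.univ.filter fun A : ι → Matrix m n K =>
        Module.finrank K ↥(⨆ i ∈ I, LinearMap.range (A i).vecMulLinear) ≤ ρ).card *
      Fintype.card K ^ (u * w) ≤ 4 * Fintype.card (ι → Matrix m n K) := by
  set q := Fintype.card K with hq
  have hq2 : 2 ≤ q := Fintype.one_lt_card
  set B := Finset.univ.filter fun A : ι → Matrix m n K =>
    Module.finrank K ↥(⨆ i ∈ I, LinearMap.range (A i).vecMulLinear) ≤ ρ with hB
  set T := Finset.univ.filter fun s : Fin ρ → n → K => LinearIndependent K s with hT
  set P := ∏ i : Fin ρ, (q ^ ρ - q ^ (i : ℕ)) with hP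
  set N := Fintype.card (ι → Matrix m n K) with hN
  let r : (ι → Matrix m n K) → (Fin ρ → n → K) → Prop := fun A s =>
    ∀ i ∈ I, LinearMap.range (A i).vecMulLinear ≤ Submodule.span K (Set.range s)
  have hqpos : 0 < q ^ (u * (I.card * Fintype.card m)) := by positivity
  have hdc := Finset.card_mul_le_card_mul (s := B) (t := T) r (m := P)
    (n := N / q ^ (u * (I.card * Fintype.card m))) (by
      intro A hA
      obtain ⟨W, hAW, hW⟩ := Submodule.exists_le_finrank_eq _ (Finset.mem_filter.1 hA).2
        (by rw [Module.finrank_fintype_fun_eq_card, hu]; exact Nat.le_add_right _ _)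
      refine (prod_le_card_linearIndependent_le_span W hW).trans (Finset.card_le_card ?_)
      intro s hs
      obtain ⟨-, hs1, hs2⟩ := Finset.mem_filter.1 hs
      refine (Finset.mem_bipartiteAbove r).2 ⟨by simpa [hT] using hs1, fun i hi => ?_⟩
      exact (le_iSup₂_of_le i hi le_rfl).trans (hAW.trans hs2)) (by
      intro s hs
      have hs1 : LinearIndependent K s := (Finset.mem_filter.1 hs).2
      rw [Nat.le_div_iff_mul_le hqpos, hN,
        ← card_forall_range_le_mul_pow I (Submodule.span K (Set.range s)) (u := u)
          (by rw [hu, finrank_span_eq_card hs1, Fintype.card_fin])]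
      refine Nat.mul_le_mul_right _ (Finset.card_le_card fun A hA => ?_)
      exact Finset.mem_filter.2 ⟨Finset.mem_univ _, ((Finset.mem_bipartiteBelow r).1 hA).2⟩)
  have hTc : T.card ≤ q ^ ((ρ + u) * ρ) := by
    refine (Finset.card_le_univ T).trans_eq ?_
    rw [Fintype.card_fun, Fintype.card_fun, Fintype.card_fin, hu, ← pow_mul]
  have hPq := pow_mul_self_le_four_mul_prod hq2 ρ
  have hdiv : N / q ^ (u * (I.card * Fintype.card m)) * q ^ (u * (ρ + w)) ≤ N := by
    rw [← hw]; exact Nat.div_mul_le_self _ _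
  set C := N / q ^ (u * (I.card * Fintype.card m))
  refine Nat.le_of_mul_le_mul_right (c := q ^ ((ρ + u) * ρ)) ?_ (by positivity)
  calc B.card * q ^ (u * w) * q ^ ((ρ + u) * ρ)
      = B.card * q ^ (ρ * ρ) * q ^ (u * (ρ + w)) := by
        rw [mul_assoc, mul_assoc, ← pow_add, ← pow_add]; congr 2; ring
    _ ≤ B.card * (4 * P) * q ^ (u * (ρ + w)) := by gcongr
    _ = 4 * (B.card * P) * q ^ (u * (ρ + w)) := by ring
    _ ≤ 4 * (q ^ ((ρ + u) * ρ) * C) * q ^ (u * (ρ + w)) := by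
        refine Nat.mul_le_mul_right _ (Nat.mul_le_mul_left _ ?_)
        exact hdc.trans (Nat.mul_le_mul_right _ hTc)
    _ = 4 * q ^ ((ρ + u) * ρ) * (C * q ^ (u * (ρ + w))) := by ring
    _ ≤ 4 * q ^ ((ρ + u) * ρ) * N := by gcongr
    _ = _ := by ring

end RankCount

theorem exp_mul_choose_mul_le {α r f q b : ℕ} {N : ℝ} (hα : 2 ≤ α) (hb : (b : ℝ) * q ^ f ≤ 4 * N)
    (hN : 0 ≤ N)
    (hr : (r : ℝ) ≤
      (((α - 1).factorial : ℝ) / (2 * Real.exp 1 * 4 * α)) ^ ((1 : ℝ) / (α - 1)) *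
        (q : ℝ) ^ ((f : ℝ) / ((α : ℝ) - 1))) :
    Real.exp 1 * α * (r - 1).choose (α - 1) * b ≤ N := by
  obtain ⟨k, rfl⟩ : ∃ k, α = k + 1 := ⟨α - 1, by omega⟩
  have hk : k ≠ 0 := by omega
  have hk' : (k : ℝ) ≠ 0 := by exact_mod_cast hk
  rw [Nat.add_sub_cancel] at hr ⊢
  have hα1 : ((k + 1 : ℕ) : ℝ) - 1 = k := by push_cast; ring
  rw [hα1] at hr
  set B : ℝ := (k.factorial : ℝ) / (2 * Real.exp 1 * 4 * (k + 1 : ℕ)) with hB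
  have hB0 : 0 ≤ B := by positivity
  have hrk : (r : ℝ) ^ k ≤ B * q ^ f := by
    refine (pow_le_pow_left₀ (Nat.cast_nonneg r) hr k).trans_eq ?_
    rw [mul_pow, ← Real.rpow_mul_natCast hB0, ← Real.rpow_mul_natCast (Nat.cast_nonneg q),
      div_mul_cancel₀ _ hk', div_mul_cancel₀ _ hk', Real.rpow_one, Real.rpow_natCast]
  have hchoose : (((r - 1).choose k : ℕ) : ℝ) ≤ r ^ k / k.factorial := by
    refine (Nat.choose_le_pow_div k (r - 1)).trans ?_
    gcongr
    exact Nat.sub_le r 1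
  have hfac : (0 : ℝ) < k.factorial := by exact_mod_cast k.factorial_pos
  calc Real.exp 1 * (k + 1 : ℕ) * (r - 1).choose k * b
      ≤ Real.exp 1 * (k + 1 : ℕ) * (B * q ^ f / k.factorial) * b := by
        gcongr
        exact hchoose.trans (by gcongr)
    _ = (b * q ^ f) / 8 := by
        rw [hB]
        field_simp
        ring
    _ ≤ N := by linarith


open Real in
theorem LLL_solution_existence (q α h ℓ t ε r : ℕ)
    (K : Type) [Field K] [Fintype K] (hq : Fintype.card K = q)
    (hα : 2 ≤ α) (hh : 1 ≤ h) (hℓ : 1 ≤ ℓ) (ht : 1 ≤ t) (hhle : h ≤ α * ℓ + ε)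
    (hr : (r : ℝ) ≤
      ((((α - 1).factorial : ℝ) / (2 * Real.exp 1 * 4 * α)) ^ ((1 : ℝ) / (α - 1))) *
        (q : ℝ) ^
          ((((α * ℓ + ε - h) * ε * t ^ 2 + (α * ℓ + 2 * ε - h) * t + 1 : ℕ) : ℝ) /
            ((α : ℝ) - 1))) :
    ∃ A : Fin r → Matrix (Fin (ℓ * t)) (Fin (h * t)) K,
      ∀ I : Finset (Fin r), I.card = α →
        (h - ε) * t ≤
          Module.finrank K ↥(⨆ i ∈ I, LinearMap.range (A i).vecMulLinear) := by
  classical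
  rcases le_or_gt h ε with hε | hε
  · exact ⟨fun _ => 0, fun I _ => by simp [Nat.sub_eq_zero_of_le hε]⟩
  have hrank : 1 ≤ (h - ε) * t := Nat.mul_pos (by omega) ht
  set f := (α * ℓ + ε - h) * ε * t ^ 2 + (α * ℓ + 2 * ε - h) * t + 1 with hf
  set ρ := (h - ε) * t - 1 with hρ
  have hcols : h * t = ρ + (ε * t + 1) := by
    have : h * t = (h - ε) * t + ε * t := by rw [← add_mul, Nat.sub_add_cancel hε.le]
    omega
  have hrows : α * (ℓ * t) = ρ + ((α * ℓ + ε - h) * t + 1) := by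
    have : α * (ℓ * t) = (h - ε) * t + (α * ℓ + ε - h) * t := by
      rw [← mul_assoc, ← add_mul]
      congr 1
      omega
    omega
  have hexp : (ε * t + 1) * ((α * ℓ + ε - h) * t + 1) = f := by
    have : α * ℓ + 2 * ε - h = (α * ℓ + ε - h) + ε := by omega
    rw [hf, this]
    ring
  set N := Fintype.card (Fin r → Matrix (Fin (ℓ * t)) (Fin (h * t)) K) with hN
  let bad : Finset (Fin r) → (Fin r → Matrix (Fin (ℓ * t)) (Fin (h * t)) K) → Prop :=
    fun I A => Module.finrank K ↥(⨆ i ∈ I, LinearMap.range (A i).vecMulLinear) ≤ ρ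
  have hcount : ∀ I : Finset (Fin r), I.card = α →
      (Finset.univ.filter (bad I)).card * q ^ f ≤ 4 * N := by
    intro I hI
    have := card_finrank_iSup_le_mul_pow_le (K := K) (m := Fin (ℓ * t)) (n := Fin (h * t)) I
      (by rw [Fintype.card_fin]; exact hcols) (by rw [hI, Fintype.card_fin]; exact hrows)
    rwa [hexp, hq] at this
  have hqf : 0 < q ^ f := Nat.pow_pos (hq ▸ Fintype.card_pos)
  obtain ⟨k, rfl⟩ : ∃ k, α = k + 1 := ⟨α - 1, by omega⟩
  have hb : ((4 * N / q ^ f : ℕ) : ℝ) * q ^ f ≤ 4 * (N : ℝ) := by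
    exact_mod_cast Nat.div_mul_le_self (4 * N) (q ^ f)
  obtain ⟨A, hA⟩ := exists_forall_not_bad (bad := bad) (k := k) (b := (4 * N / q ^ f : ℕ))
    (by omega) (Nat.cast_nonneg _)
    (fun I A A' hAA' hA => by
      have : (⨆ i ∈ I, LinearMap.range (A i).vecMulLinear) =
          ⨆ i ∈ I, LinearMap.range (A' i).vecMulLinear :=
        biSup_congr fun i hi => by rw [hAA' i hi]
      exact (congrArg (fun U : Submodule K (Fin (h * t) → K) => Module.finrank K U)
        this).symm.trans_le hA)
    (fun I hI => by
      rw [Nat.cast_le, Nat.le_div_iff_mul_le hqf]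
      convert hcount I hI)
    (by
      have := exp_mul_choose_mul_le hα hb (Nat.cast_nonneg N) hr
      rwa [Nat.cast_succ, Nat.add_sub_cancel, ← Fintype.card_fin r] at this)
  refine ⟨A, fun I hI => ?_⟩
  have := hA I hI
  simp only [bad, not_le] at this
  omega
end

section
/- For integers α ≥ 2, ℓ, ε ≥ 1, h with 2ℓ + ε < h ≤ αℓ + ε, and r such that r + θ - α > γθ where θ = α - ⌊(h-ε)/ℓ⌋ + 1 and γ = 4: let q_s be the minimum prime power q admitting a scalar solution. Then any q admitting a scalar solution satisfies q ≥ ((r+θ-α)/(γθ))^{1/(ℓ(ε+1))}, while there exists a (2, t_Δ)-vector solution, where t_Δ is the least positive integer t with 2^{f(t)/(α-1)} ≥ r/β. Consequently log₂(q_s) - t_Δ ≥ (1/(ℓ(ε+1)))·log₂((r+θ-α)/(γθ)) - t_Δ. -/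
/-- The `(ε,ℓ)-N_{h,r,αℓ+ε}` generalized combination network has a `(q,t)`-linear
solution: there are coding matrices `A_1, …, A_r` over a field with `q` elements such
that every `α` of them stack to a matrix of rank at least `(h-ε)t` (the rank of the
stacked matrix being the dimension of the sum of the row spaces). -/
def HasLinearSol (α h ℓ ε r q t : ℕ) : Prop :=
  ∃ (K : Type) (_ : Field K) (_ : Fintype K), Fintype.card K = q ∧
    ∃ A : Fin r → Matrix (Fin (ℓ * t)) (Fin (h * t)) K,
      ∀ I : Finset (Fin r), I.card = α →
        (h - ε) * t ≤ Module.finrank K ↥(⨆ i ∈ I, LinearMap.range (A i).vecMulLinear)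

/-- `β = ((α-1)!/(2eγα))^{1/(α-1)}` with `γ = 4`. -/
noncomputable def betaConst (α : ℕ) : ℝ :=
  (((α - 1).factorial : ℝ) / (2 * Real.exp 1 * 4 * α)) ^ ((1 : ℝ) / (α - 1))

/-- `f(t) = (αℓ+ε-h)εt² + (αℓ+2ε-h)t + 1`. -/
def fPoly (α ℓ ε h t : ℕ) : ℕ :=
  (α * ℓ + ε - h) * ε * t ^ 2 + (α * ℓ + 2 * ε - h) * t + 1

/-- `θ = α - ⌊(h-ε)/ℓ⌋ + 1`. -/
def thetaVal (α h ℓ ε : ℕ) : ℕ := α - (h - ε) / ℓ + 1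

theorem prod_pow_sub_pow_lower_bound {q : ℝ} (hq : 2 ≤ q) (n : ℕ) :
    q ^ ((n + 1) * (n + 1)) + 2 * q ^ (n * (n + 1)) ≤
      4 * ∏ i ∈ Finset.range (n + 1), (q ^ (n + 1) - q ^ i) := by
  induction n with
  | zero => norm_num; linarith
  | succ n ih =>
    have hprod : ∏ i ∈ Finset.range (n + 1 + 1), (q ^ (n + 1 + 1) - q ^ i) =
        q ^ (n + 1) * (q * q ^ (n + 1) - 1) *
          ∏ i ∈ Finset.range (n + 1), (q ^ (n + 1) - q ^ i) := by
      rw [Finset.prod_range_succ']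
      have : ∀ i ∈ Finset.range (n + 1), q ^ (n + 1 + 1) - q ^ (i + 1) =
          q * (q ^ (n + 1) - q ^ i) := fun i _ => by ring
      rw [Finset.prod_congr rfl this, Finset.prod_mul_distrib, Finset.prod_const,
        Finset.card_range]
      ring
    have hy : 2 ≤ q ^ (n + 1) :=
      hq.trans (le_self_pow₀ (by linarith) (by omega))
    rw [hprod]
    have e1 : q ^ ((n + 1 + 1) * (n + 1 + 1)) =
        q ^ (n * (n + 1)) * ((q ^ (n + 1)) ^ 3 * q) := by ring
    have e2 : q ^ ((n + 1) * (n + 1 + 1)) = q ^ (n * (n + 1)) * (q ^ (n + 1)) ^ 2 := by ring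
    have e3 : q ^ ((n + 1) * (n + 1)) = q ^ (n * (n + 1)) * q ^ (n + 1) := by ring
    rw [e1, e2]
    rw [e3] at ih
    have hA : 0 < q ^ (n * (n + 1)) := by positivity
    generalize q ^ (n * (n + 1)) = A at *
    generalize q ^ (n + 1) = y at *
    generalize ∏ i ∈ Finset.range (n + 1), (y - q ^ i) = P at *
    have hqy : 4 ≤ q * y := by nlinarith
    have hc : 0 ≤ y * (q * y - 1) := by nlinarith
    have h1 := mul_le_mul_of_nonneg_left ih hc
    have h2 : y ^ 2 * q + 2 * y ≤ (q * y - 1) * (y + 2) := by nlinarith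
    have h3 := mul_le_mul_of_nonneg_left h2 (by positivity : 0 ≤ A * y)
    nlinarith

theorem exists_surjective_le_ker {K V : Type*} [Field K] [AddCommGroup V] [Module K V]
    [Module.Finite K V] (U : Submodule K V) {s : ℕ}
    (hs : Module.finrank K U + s ≤ Module.finrank K V) :
    ∃ φ : V →ₗ[K] (Fin s → K), Function.Surjective φ ∧ U ≤ LinearMap.ker φ := by
  have hq := U.finrank_quotient_add_finrank
  have hle : s ≤ Module.finrank K (V ⧸ U) := by omega
  refine ⟨(LinearMap.funLeft K K (Fin.castLE hle)) ∘ₗ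
    (Module.finBasis K (V ⧸ U)).equivFun.toLinearMap ∘ₗ U.mkQ, ?_, ?_⟩
  · exact (LinearMap.funLeft_surjective_of_injective K K _ (Fin.castLE_injective hle)).comp
      ((Module.finBasis K (V ⧸ U)).equivFun.surjective.comp U.mkQ_surjective)
  · intro x hx
    simp [(Submodule.Quotient.mk_eq_zero U).mpr hx]

section

variable {K : Type*} [Field K] [Fintype K]

theorem pow_sq_le_four_mul_card_GL {s : ℕ} (hs : 1 ≤ s) :
    Fintype.card K ^ (s * s) ≤ 4 * Nat.card (GL (Fin s) K) := by
  obtain ⟨n, rfl⟩ : ∃ n, s = n + 1 := ⟨s - 1, by omega⟩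
  have hq : (2 : ℝ) ≤ Fintype.card K := by exact_mod_cast Fintype.one_lt_card (α := K)
  rw [Matrix.card_GL_field, Fin.prod_univ_eq_prod_range
    (fun i => Fintype.card K ^ (n + 1) - Fintype.card K ^ i)]
  have h := prod_pow_sub_pow_lower_bound hq n
  have hcast : ((∏ i ∈ Finset.range (n + 1),
      (Fintype.card K ^ (n + 1) - Fintype.card K ^ i) : ℕ) : ℝ) =
      ∏ i ∈ Finset.range (n + 1), ((Fintype.card K : ℝ) ^ (n + 1) - (Fintype.card K : ℝ) ^ i) := by
    rw [Nat.cast_prod]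
    refine Finset.prod_congr rfl fun i hi => ?_
    rw [Nat.cast_sub (Nat.pow_le_pow_right Fintype.card_pos (Finset.mem_range.mp hi).le)]
    push_cast
    rfl
  rw [← hcast] at h
  have h0 : (0 : ℝ) ≤ 2 * (Fintype.card K : ℝ) ^ (n * (n + 1)) := by positivity
  exact_mod_cast (le_add_of_nonneg_right h0).trans h

variable {V : Type*} [AddCommGroup V] [Module K V] [Module.Finite K V]

theorem card_GL_le_card_surjective_le_ker (U : Submodule K V) {s : ℕ}
    (hs : Module.finrank K U + s ≤ Module.finrank K V) :
    Nat.card (GL (Fin s) K) ≤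
      Nat.card {φ : V →ₗ[K] (Fin s → K) // Function.Surjective φ ∧ U ≤ LinearMap.ker φ} := by
  obtain ⟨φ, hφ, hU⟩ := exists_surjective_le_ker U hs
  have : Finite (V →ₗ[K] (Fin s → K)) := Module.finite_of_finite K
  let g (A : GL (Fin s) K) := Matrix.GeneralLinearGroup.toLin A
  have hg (A) : Function.Bijective (g A).1 :=
    (LinearMap.GeneralLinearGroup.toLinearEquiv (g A)).bijective
  refine Nat.card_le_card_of_injective
    (fun A => ⟨(g A).1 ∘ₗ φ, (hg A).surjective.comp hφ, fun x hx => ?_⟩) ?_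
  · have := LinearMap.mem_ker.mp (hU hx)
    simp [this]
  · intro A B h
    apply (Matrix.GeneralLinearGroup.toLin (n := Fin s) (R := K)).injective
    refine Units.ext (LinearMap.ext fun y => ?_)
    obtain ⟨x, rfl⟩ := hφ y
    exact LinearMap.congr_fun (Subtype.ext_iff.mp h) x

open scoped Classical in
/-- Double counting of subspaces against the surjections onto `K ^ s` killing them. -/
theorem card_mul_pow_sq_le {ι : Type*} (S : Finset ι) (U : ι → Submodule K V) {s c : ℕ}
    (hs : 1 ≤ s) (hU : ∀ i ∈ S, Module.finrank K (U i) + s ≤ Module.finrank K V)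
    (hc : ∀ φ : V →ₗ[K] (Fin s → K), Function.Surjective φ →
      (S.filter fun i => U i ≤ LinearMap.ker φ).card ≤ c) :
    S.card * Fintype.card K ^ (s * s) ≤ 4 * (Fintype.card K ^ (Module.finrank K V * s) * c) := by
  have : Finite (V →ₗ[K] (Fin s → K)) := Module.finite_of_finite K
  let := Fintype.ofFinite (V →ₗ[K] (Fin s → K))
  have key := Finset.card_mul_le_card_mul (s := S)
    (t := {φ : V →ₗ[K] (Fin s → K) | Function.Surjective φ})
    (fun i φ => U i ≤ LinearMap.ker φ) (m := Nat.card (GL (Fin s) K)) (n := c)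
    (fun i hi => by
      refine (card_GL_le_card_surjective_le_ker (U i) (hU i hi)).trans_eq ?_
      rw [Nat.card_eq_fintype_card, Fintype.card_subtype, Finset.bipartiteAbove,
        Finset.filter_filter])
    (fun φ hφ => hc φ (Finset.mem_filter.mp hφ).2)
  have hcard : Finset.card {φ : V →ₗ[K] (Fin s → K) | Function.Surjective φ} ≤
      Fintype.card K ^ (Module.finrank K V * s) := by
    refine (Finset.card_le_univ _).trans_eq ?_
    rw [← Nat.card_eq_fintype_card, Module.natCard_eq_pow_finrank (K := K),
      Module.finrank_linearMap, Module.finrank_fin_fun, Nat.card_eq_fintype_card]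
  calc S.card * Fintype.card K ^ (s * s)
      ≤ S.card * (4 * Nat.card (GL (Fin s) K)) :=
        Nat.mul_le_mul_left _ (pow_sq_le_four_mul_card_GL hs)
    _ = 4 * (S.card * Nat.card (GL (Fin s) K)) := by ring
    _ ≤ _ := Nat.mul_le_mul_left _ (key.trans (Nat.mul_le_mul_right _ hcard))

end

section

variable {ι X : Type*} [Fintype ι] [DecidableEq ι] [Fintype X]

open scoped Classical in
theorem card_and_mul_card_le (I : Finset ι) (P Q : (ι → X) → Prop)
    (hP : ∀ f g, (∀ i ∉ I, f i = g i) → P f → P g)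
    (hQ : ∀ f g, (∀ i ∈ I, f i = g i) → Q f → Q g) :
    (Finset.univ.filter fun f => P f ∧ Q f).card * Fintype.card (ι → X) ≤
      (Finset.univ.filter P).card * (Finset.univ.filter Q).card := by
  rw [← Finset.card_univ, ← Finset.card_product, ← Finset.card_product]
  refine Finset.card_le_card_of_injOn
    (fun x => (I.piecewise x.2 x.1, I.piecewise x.1 x.2)) ?_ ?_
  · rintro ⟨f, g⟩ hfg
    simp only [Finset.coe_product, Set.mem_prod, Finset.mem_coe, Finset.mem_filter,
      Finset.mem_univ, true_and, and_true] at hfg ⊢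
    exact ⟨hP f _ (fun i hi => by simp [hi]) hfg.1, hQ f _ (fun i hi => by simp [hi]) hfg.2⟩
  · rintro ⟨f, g⟩ - ⟨f', g'⟩ - h
    simp only [Prod.mk.injEq] at h ⊢
    constructor <;> funext i <;> have h1 := congrFun h.1 i <;> have h2 := congrFun h.2 i <;>
      by_cases hi : i ∈ I <;> simp_all

/-- No `α`-subset of `S` is bad for the assignment `f`. -/
def NoBadSubset (α : ℕ) (Bad : Finset ι → (ι → X) → Prop) (S : Finset ι) (f : ι → X) : Prop :=
  ∀ I ⊆ S, I.card = α → ¬ Bad I f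

open scoped Classical in
/-- The number of assignments for which no `α`-subset of `S` is bad. -/
noncomputable def numValid (α : ℕ) (Bad : Finset ι → (ι → X) → Prop) (S : Finset ι) : ℕ :=
  (Finset.univ.filter fun f : ι → X => NoBadSubset α Bad S f).card

variable {α : ℕ} {Bad : Finset ι → (ι → X) → Prop}

open scoped Classical in
theorem numValid_le_numValid_insert_add (S : Finset ι) (a : ι) :
    numValid α Bad S ≤ numValid α Bad (insert a S) +
      ∑ J ∈ S.powersetCard (α - 1), (Finset.univ.filter fun f : ι → X =>
        NoBadSubset α Bad (S \ J) f ∧ Bad (insert a J) f).card := by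
  refine le_trans ?_ (Nat.add_le_add_left Finset.card_biUnion_le _)
  refine le_trans (Finset.card_le_card ?_) (Finset.card_union_le _ _)
  intro f hf
  simp only [Finset.mem_filter, Finset.mem_univ, true_and, Finset.mem_union,
    Finset.mem_biUnion, Finset.mem_powersetCard] at hf ⊢
  simp only [NoBadSubset] at hf ⊢
  by_contra! hcon
  obtain ⟨⟨I, hIS, hIc, hI⟩, h2⟩ := hcon
  have haI : a ∈ I := by
    by_contra ha
    exact hf I ((Finset.subset_insert_iff_of_notMem ha).mp hIS) hIc hI
  refine h2 (I.erase a) ⟨Finset.subset_insert_iff.mp hIS, ?_⟩ ?_ ?_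
  · rw [Finset.card_erase_of_mem haI, hIc]
  · exact fun I' hI' => hf I' (hI'.trans Finset.sdiff_subset)
  · rwa [Finset.insert_erase haI]

variable [Nonempty X]

open scoped Classical in
theorem mul_numValid_le_numValid_insert
    (hBad : ∀ I f g, (∀ i ∈ I, f i = g i) → Bad I f → Bad I g) (hα : 1 ≤ α)
    {p x : ℝ} (hp0 : 0 ≤ p) (hx0 : 0 < x)
    (hp : ∀ I, I.card = α → ((Finset.univ.filter (Bad I)).card : ℝ) ≤ p * Fintype.card (ι → X))
    (hx : x + (Fintype.card ι).choose (α - 1) * p / x ^ (α - 1) ≤ 1) (n : ℕ) :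
    ∀ (S : Finset ι) (a : ι), S.card = n → a ∉ S →
      x * numValid α Bad S ≤ numValid α Bad (insert a S) := by
  induction n using Nat.strong_induction_on with
  | _ n ih =>
  intro S a hSn haS
  have hpow : ∀ J T : Finset ι, Disjoint J T → (T ∪ J).card ≤ n →
      x ^ J.card * numValid α Bad T ≤ numValid α Bad (T ∪ J) := by
    intro J T
    induction J using Finset.induction_on with
    | empty => simp
    | insert b J hb ihJ =>
      intro hd hc
      rw [Finset.disjoint_insert_left] at hd
      have hbT : b ∉ T ∪ J := by simp [hd.1, hb]
      rw [Finset.union_insert, Finset.card_insert_of_notMem hbT] at hc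
      rw [Finset.union_insert, Finset.card_insert_of_notMem hb, pow_succ']
      refine le_trans ?_ (ih _ (by omega) _ b rfl hbT)
      rw [mul_assoc]
      exact mul_le_mul_of_nonneg_left (ihJ hd.2 (by omega)) hx0.le
  have hterm : ∀ J ∈ S.powersetCard (α - 1), ((Finset.univ.filter fun f : ι → X =>
      NoBadSubset α Bad (S \ J) f ∧ Bad (insert a J) f).card : ℝ) ≤
      p * numValid α Bad S / x ^ (α - 1) := by
    intro J hJ
    rw [Finset.mem_powersetCard] at hJ
    have haJ : a ∉ J := fun h => haS (hJ.1 h)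
    have hind := card_and_mul_card_le (X := X) (insert a J)
      (NoBadSubset α Bad (S \ J)) (Bad (insert a J))
      (fun f g hfg hf I hI hIc hIg => hf I hI hIc (hBad I g f (fun i hi => by
        have h1 := Finset.mem_sdiff.mp (hI hi)
        refine (hfg i fun h => ?_).symm
        rcases Finset.mem_insert.mp h with rfl | h
        · exact haS h1.1
        · exact h1.2 h) hIg))
      (hBad _)
    have hind' : ((Finset.univ.filter fun f : ι → X =>
        NoBadSubset α Bad (S \ J) f ∧ Bad (insert a J) f).card : ℝ) *
          Fintype.card (ι → X) ≤ numValid α Bad (S \ J) *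
          (Finset.univ.filter (Bad (insert a J))).card := by exact_mod_cast hind
    have hcard : (0 : ℝ) < Fintype.card (ι → X) :=
      Nat.cast_pos.mpr Fintype.card_pos
    have hcardJ : (insert a J).card = α := by
      rw [Finset.card_insert_of_notMem haJ, hJ.2, Nat.sub_add_cancel hα]
    have h1 := hp (insert a J) hcardJ
    have h2 := hpow J (S \ J) Finset.disjoint_sdiff
      (by rw [Finset.sdiff_union_of_subset hJ.1, hSn])
    rw [Finset.sdiff_union_of_subset hJ.1, hJ.2] at h2
    have h3 := hind'.trans (mul_le_mul_of_nonneg_left h1 (Nat.cast_nonneg _))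
    rw [← mul_assoc] at h3
    rw [le_div_iff₀ (by positivity)]
    refine (mul_le_mul_of_nonneg_right (le_of_mul_le_mul_right h3 hcard)
      (by positivity)).trans ?_
    have h4 := mul_le_mul_of_nonneg_left h2 hp0
    linarith
  have hsum : (numValid α Bad S : ℝ) ≤ numValid α Bad (insert a S) +
      ∑ J ∈ S.powersetCard (α - 1), ((Finset.univ.filter fun f : ι → X =>
        NoBadSubset α Bad (S \ J) f ∧ Bad (insert a J) f).card : ℝ) := by
    exact_mod_cast numValid_le_numValid_insert_add S a
  have hsum2 := Finset.sum_le_card_nsmul _ _ _ hterm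
  rw [Finset.card_powersetCard, nsmul_eq_mul] at hsum2
  have hch : (S.card.choose (α - 1) : ℝ) ≤ (Fintype.card ι).choose (α - 1) := by
    exact_mod_cast Nat.choose_le_choose _ (Finset.card_le_univ S)
  have hN : (0 : ℝ) ≤ numValid α Bad S := Nat.cast_nonneg _
  have h5 := mul_le_mul_of_nonneg_right hch
    (by positivity : 0 ≤ p * numValid α Bad S / x ^ (α - 1))
  have h6 := mul_le_mul_of_nonneg_right hx hN
  have h7 : (x + (Fintype.card ι).choose (α - 1) * p / x ^ (α - 1)) * numValid α Bad S =
    x * numValid α Bad S +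
      (Fintype.card ι).choose (α - 1) * (p * numValid α Bad S / x ^ (α - 1)) := by ring
  linarith

open scoped Classical in
/-- A version of the symmetric local lemma for the events `Bad I` with `I` an `α`-subset. -/
theorem exists_forall_not_bad_s19
    (hBad : ∀ I f g, (∀ i ∈ I, f i = g i) → Bad I f → Bad I g) (hα : 1 ≤ α)
    {p x : ℝ} (hp0 : 0 ≤ p) (hx0 : 0 < x)
    (hp : ∀ I, I.card = α → ((Finset.univ.filter (Bad I)).card : ℝ) ≤ p * Fintype.card (ι → X))
    (hx : x + (Fintype.card ι).choose (α - 1) * p / x ^ (α - 1) ≤ 1) :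
    ∃ f : ι → X, ∀ I, I.card = α → ¬ Bad I f := by
  have hpos : ∀ S : Finset ι, (0 : ℝ) < numValid α Bad S := by
    intro S
    induction S using Finset.induction_on with
    | empty =>
      rw [Nat.cast_pos, numValid, Finset.card_pos]
      refine ⟨Classical.arbitrary _, ?_⟩
      simp only [Finset.mem_filter, Finset.mem_univ, true_and]
      simp only [NoBadSubset, Finset.subset_empty]
      rintro I rfl h
      simp at h
      omega
    | insert a S ha ih =>
      exact (mul_pos hx0 ih).trans_le
        (mul_numValid_le_numValid_insert hBad hα hp0 hx0 hp hx _ S a rfl ha)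
  obtain ⟨f, hf⟩ := Finset.card_pos.mp (Nat.cast_pos.mp (hpos Finset.univ))
  exact ⟨f, fun I => (Finset.mem_filter.mp hf).2 I (Finset.subset_univ I)⟩

end

theorem finrank_biSup_le {K ι V : Type*} [Field K] [AddCommGroup V] [Module K V] [Module.Finite K V]
    (U : ι → Submodule K V) {d : ℕ} (hdim : ∀ i, Module.finrank K (U i) ≤ d) (J : Finset ι) :
    Module.finrank K ↥(⨆ i ∈ J, U i) ≤ J.card * d := by
  classical
  induction J using Finset.induction_on with
  | empty => simp
  | insert a J ha ih =>
    rw [Finset.iSup_insert, Finset.card_insert_of_notMem ha]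
    have h1 := Submodule.finrank_add_le_finrank_add_finrank (U a) (⨆ i ∈ J, U i)
    have h2 := hdim a
    linarith

section

variable {K : Type*} [Field K] [Fintype K]

theorem card_sub_le_of_finrank_biSup {V : Type*} [AddCommGroup V] [Module K V]
    [Module.Finite K V] {r α d j m : ℕ} (U : Fin r → Submodule K V)
    (hdim : ∀ i, Module.finrank K (U i) ≤ d)
    (hspan : ∀ I : Finset (Fin r), I.card = α →
      Module.finrank K V < Module.finrank K ↥(⨆ i ∈ I, U i) + m)
    (hm : 1 ≤ m) (hj : j * d + (d + m) ≤ Module.finrank K V) (hjα : j < α) (hjr : j ≤ r) :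
    r - j ≤ 4 * (α - 1 - j) * Fintype.card K ^ (d * m) := by
  classical
  obtain ⟨J, hJ⟩ : ∃ J : Finset (Fin r), J.card = j := by
    obtain ⟨J, -, hJ⟩ := Finset.exists_subset_card_eq (s := (Finset.univ : Finset (Fin r)))
      (n := j) (by simpa using hjr)
    exact ⟨J, hJ⟩
  obtain ⟨ψ, hψ, hJψ⟩ := exists_surjective_le_ker (⨆ i ∈ J, U i) (s := d + m)
    (by have := finrank_biSup_le U hdim J; rw [hJ] at this; omega)
  have hmap (i) : Module.finrank K ((U i).map ψ) ≤ d :=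
    (Submodule.finrank_map_le ψ (U i)).trans (hdim i)
  have key := card_mul_pow_sq_le (Finset.univ \ J) (fun i => (U i).map ψ) (s := m)
    (c := α - 1 - j) hm (fun i _ => by
      rw [Module.finrank_fin_fun]; exact Nat.add_le_add_right (hmap i) m) (fun φ hφ => by
      by_contra! hcon
      obtain ⟨T, hT, hTc⟩ := Finset.exists_subset_card_eq
        (show α - j ≤ (((Finset.univ \ J).filter fun i =>
          (U i).map ψ ≤ LinearMap.ker φ).card) by omega)
      have hdisj : Disjoint J T := by
        rw [Finset.disjoint_left]
        intro i hi hiT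
        exact (Finset.mem_sdiff.mp (Finset.mem_filter.mp (hT hiT)).1).2 hi
      have hspan' := hspan (J ∪ T) (by rw [Finset.card_union_of_disjoint hdisj]; omega)
      have hle : (⨆ i ∈ J ∪ T, U i) ≤ LinearMap.ker (φ ∘ₗ ψ) := by
        refine iSup₂_le fun i hi x hx => ?_
        rw [LinearMap.mem_ker, LinearMap.comp_apply]
        rcases Finset.mem_union.mp hi with hi | hi
        · rw [LinearMap.mem_ker.mp (hJψ (le_iSup₂ (f := fun i _ => U i) i hi hx)), map_zero]
        · have hi' : (U i).map ψ ≤ LinearMap.ker φ := (Finset.mem_filter.mp (hT hi)).2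
          exact LinearMap.mem_ker.mp (hi' (Submodule.mem_map_of_mem hx))
      have h1 := Submodule.finrank_mono hle
      have h2 := LinearMap.finrank_range_add_finrank_ker (φ ∘ₗ ψ)
      have h3 : Function.Surjective (φ ∘ₗ ψ) := hφ.comp hψ
      rw [LinearMap.range_eq_top.mpr h3, finrank_top, Module.finrank_fin_fun] at h2
      omega)
  rw [Finset.card_sdiff_of_subset (Finset.subset_univ J), Finset.card_univ, Fintype.card_fin, hJ,
    Module.finrank_fin_fun, add_mul, pow_add] at key
  refine Nat.le_of_mul_le_mul_right (key.trans_eq ?_)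
    (pow_pos Fintype.card_pos (m * m) : 0 < Fintype.card K ^ (m * m))
  ring

open scoped Classical in
/-- Counting families of matrices whose stacked rank over `I` is at most `M - s`. -/
theorem card_filter_finrank_add_le {r L M s : ℕ} (I : Finset (Fin r)) (hs : 1 ≤ s)
    (hM : M ≤ s + I.card * L) :
    (Finset.univ.filter fun f : Fin r → Matrix (Fin L) (Fin M) K =>
      Module.finrank K ↥(⨆ i ∈ I, LinearMap.range (f i).vecMulLinear) + s ≤ M).card *
        Fintype.card K ^ (s * (s + I.card * L - M)) ≤
      4 * Fintype.card (Fin r → Matrix (Fin L) (Fin M) K) := by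
  have hq : 0 < Fintype.card K := Fintype.card_pos
  have hle : s * (I.card * L) ≤ r * (L * M) ∨ M < s := by
    by_cases h : s ≤ M
    · left
      have := (Finset.card_le_univ I).trans_eq (Fintype.card_fin r)
      calc s * (I.card * L) ≤ M * (r * L) := by gcongr
        _ = _ := by ring
    · right; omega
  rcases hle with hle | hlt
  swap
  · rw [Finset.filter_false_of_mem (fun f _ => by omega)]
    simp
  have htot : Fintype.card (Fin r → Matrix (Fin L) (Fin M) K) =
      Fintype.card K ^ (r * (L * M)) := by
    rw [← Nat.card_eq_fintype_card, Module.natCard_eq_pow_finrank (K := K),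
      Module.finrank_pi_fintype, Nat.card_eq_fintype_card]
    simp [Module.finrank_matrix]
  have key := card_mul_pow_sq_le (V := Fin M → K)
    (Finset.univ.filter fun f : Fin r → Matrix (Fin L) (Fin M) K =>
      Module.finrank K ↥(⨆ i ∈ I, LinearMap.range (f i).vecMulLinear) + s ≤ M)
    (fun f => ⨆ i ∈ I, LinearMap.range (f i).vecMulLinear) (s := s)
    (c := Fintype.card K ^ (r * (L * M) - s * (I.card * L))) hs
    (fun f hf => by
      rw [Module.finrank_fin_fun]; exact (Finset.mem_filter.mp hf).2) (fun φ hφ => by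
      let T : (Fin r → Matrix (Fin L) (Fin M) K) →ₗ[K] (I × Fin L → Fin s → K) :=
        { toFun := fun f p => φ (f p.1 p.2)
          map_add' := fun f g => by funext p; exact congrFun (map_add φ _ _) |> funext
          map_smul' := fun c f => by funext p; exact congrFun (map_smul φ _ _) |> funext }
      have hT : Function.Surjective T := by
        intro y
        choose g hg using hφ
        refine ⟨fun i a => if h : i ∈ I then g (y (⟨i, h⟩, a)) else 0, ?_⟩
        funext p
        change φ (if h : (p.1 : Fin r) ∈ I then g (y (⟨p.1, h⟩, p.2)) else 0) = y p
        rw [dif_pos p.1.2, hg]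
      have h2 := LinearMap.finrank_range_add_finrank_ker T
      rw [LinearMap.range_eq_top.mpr hT, finrank_top] at h2
      have h3 : Module.finrank K (LinearMap.ker T) = r * (L * M) - s * (I.card * L) := by
        have e1 : Module.finrank K (I × Fin L → Fin s → K) = s * (I.card * L) := by
          rw [Module.finrank_pi_fintype]; simp; ring
        have e2 : Module.finrank K (Fin r → Matrix (Fin L) (Fin M) K) = r * (L * M) := by
          rw [Module.finrank_pi_fintype]; simp [Module.finrank_matrix]
        omega
      rw [← h3, ← Nat.card_eq_fintype_card, ← Module.natCard_eq_pow_finrank (K := K),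
        Nat.subtype_card (p := fun f => f ∈ LinearMap.ker T)
          (Finset.univ.filter fun f => f ∈ LinearMap.ker T) (by simp)]
      refine Finset.card_le_card fun f hf => ?_
      have hf' : (⨆ i ∈ I, LinearMap.range (f i).vecMulLinear) ≤ LinearMap.ker φ :=
        (Finset.mem_filter.mp hf).2
      rw [Finset.mem_filter]
      refine ⟨Finset.mem_univ f, LinearMap.mem_ker.mpr (funext fun p => ?_)⟩
      refine LinearMap.mem_ker.mp (hf' ?_)
      refine le_iSup₂ (f := fun i (_ : i ∈ I) => LinearMap.range (f i).vecMulLinear)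
        (p.1 : Fin r) p.1.2 ⟨Pi.single p.2 1, ?_⟩
      rw [Matrix.vecMulLinear_apply, Matrix.single_one_vecMul]
      rfl)
  rw [htot, Module.finrank_fin_fun] at *
  have e : r * (L * M) - s * (I.card * L) + s * (I.card * L) = r * (L * M) := by omega
  have e' : s * s + s * (I.card * L) = s * (s + I.card * L - M) + M * s := by
    have : s + I.card * L - M + M = s + I.card * L := by omega
    calc s * s + s * (I.card * L) = s * (s + I.card * L - M + M) := by rw [this]; ring
      _ = _ := by ring
  refine Nat.le_of_mul_le_mul_right (c := Fintype.card K ^ (M * s)) ?_ (pow_pos hq _)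
  rw [mul_assoc, ← pow_add, ← e', pow_add, ← mul_assoc]
  refine (Nat.mul_le_mul_right _ key).trans_eq ?_
  rw [← e, pow_add, e]
  ring

end

theorem scalar_solution_bound {α ℓ ε h r q : ℕ} (hℓ : 1 ≤ ℓ) (hh : 2 * ℓ + ε < h)
    (hhle : h ≤ α * ℓ + ε)
    (hrθ : 4 * (thetaVal α h ℓ ε : ℝ) < (r : ℝ) + (thetaVal α h ℓ ε : ℝ) - α)
    (hsol : HasLinearSol α h ℓ ε r q 1) :
    (r : ℝ) + (thetaVal α h ℓ ε : ℝ) - α ≤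
      4 * (thetaVal α h ℓ ε : ℝ) * (q : ℝ) ^ (ℓ * (ε + 1)) := by
  obtain ⟨K, _, _, rfl, A, hA⟩ := hsol
  have hr : 4 * thetaVal α h ℓ ε + α < r + thetaVal α h ℓ ε := by
    have : (4 * (thetaVal α h ℓ ε : ℝ)) + α < r + thetaVal α h ℓ ε := by linarith
    exact_mod_cast this
  have hθ : thetaVal α h ℓ ε = α - (h - ε) / ℓ + 1 := rfl
  have hk2 : 2 ≤ (h - ε) / ℓ := (Nat.le_div_iff_mul_le hℓ).mpr (by omega)
  have hkα : (h - ε) / ℓ ≤ α := Nat.div_le_of_le_mul (by rw [mul_comm]; omega)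
  have hkm : (h - ε) / ℓ * ℓ ≤ h - ε := Nat.div_mul_le_self _ _
  generalize thetaVal α h ℓ ε = θ at *
  generalize (h - ε) / ℓ = k at *
  obtain ⟨j, rfl⟩ : ∃ j, k = j + 2 := ⟨k - 2, by omega⟩
  have key := card_sub_le_of_finrank_biSup (α := α) (d := ℓ) (j := j) (m := ε + 1)
    (fun i => LinearMap.range (A i).vecMulLinear)
    (fun i => (LinearMap.finrank_range_le _).trans_eq (by simp))
    (fun I hI => by
      have := hA I hI
      rw [Module.finrank_fin_fun]
      omega) (by omega) (by
        rw [Module.finrank_fin_fun]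
        have : (j + 2) * ℓ = j * ℓ + 2 * ℓ := by ring
        omega) (by omega) (by omega)
  have hjθ : α - 1 - j = θ := by omega
  rw [hjθ] at key
  have h1 : r + θ ≤ 4 * θ * Fintype.card K ^ (ℓ * (ε + 1)) + α := by omega
  have h2 : (r : ℝ) + θ ≤ 4 * θ * (Fintype.card K : ℝ) ^ (ℓ * (ε + 1)) + α := by
    exact_mod_cast h1
  linarith

theorem inv_exp_one_le_one_sub_inv_pow {α : ℕ} (hα : 2 ≤ α) :
    (Real.exp 1)⁻¹ ≤ (1 - 1 / (α : ℝ)) ^ (α - 1) := by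
  obtain ⟨n, rfl⟩ : ∃ n, α = n + 2 := ⟨α - 2, by omega⟩
  have hn : (0 : ℝ) < (n : ℝ) + 1 := by positivity
  have h1 : (1 + 1 / ((n : ℝ) + 1)) ^ (n + 1) ≤ Real.exp 1 := by
    have h2 : 1 + 1 / ((n : ℝ) + 1) ≤ Real.exp (1 / ((n : ℝ) + 1)) := by
      rw [add_comm]; exact Real.add_one_le_exp _
    refine (pow_le_pow_left₀ (by positivity) h2 _).trans_eq ?_
    rw [← Real.exp_nat_mul]
    congr 1
    push_cast
    field_simp
  have h3 : (1 - 1 / ((n + 2 : ℕ) : ℝ)) = (1 + 1 / ((n : ℝ) + 1))⁻¹ := by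
    push_cast
    field_simp
    ring
  rw [h3, inv_pow]
  exact inv_anti₀ (by positivity) h1

theorem hasLinearSol_two_of_le {α ℓ ε h r t : ℕ} (hα : 2 ≤ α) (hh : ε < h)
    (hhle : h ≤ α * ℓ + ε)
    (hbound : (r : ℝ) / betaConst α ≤
      (2 : ℝ) ^ ((fPoly α ℓ ε h t : ℝ) / ((α : ℝ) - 1))) :
    HasLinearSol α h ℓ ε r 2 t := by
  classical
  have hα0 : (0 : ℝ) < α := by positivity
  have hα1 : (0 : ℝ) < (α : ℝ) - 1 := by
    have : (2 : ℝ) ≤ α := by exact_mod_cast hα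
    linarith
  have hcast : ((α - 1 : ℕ) : ℝ) = (α : ℝ) - 1 := by
    rw [Nat.cast_sub (by omega)]; simp
  have hfac : (0 : ℝ) < (α - 1).factorial := by exact_mod_cast Nat.factorial_pos _
  have hβ : 0 < betaConst α := by unfold betaConst; positivity
  have hβpow : betaConst α ^ (α - 1) =
      ((α - 1).factorial : ℝ) / (2 * Real.exp 1 * 4 * α) := by
    rw [betaConst, ← Real.rpow_natCast, ← Real.rpow_mul (by positivity), hcast,
      one_div_mul_cancel hα1.ne', Real.rpow_one]
  have hrpow : (r : ℝ) ^ (α - 1) ≤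
      2 ^ fPoly α ℓ ε h t * (((α - 1).factorial : ℝ) / (2 * Real.exp 1 * 4 * α)) := by
    rw [div_le_iff₀ hβ] at hbound
    have h1 := pow_le_pow_left₀ (Nat.cast_nonneg r) hbound (α - 1)
    rwa [mul_pow, hβpow, ← Real.rpow_mul_natCast (by norm_num), hcast,
      div_mul_cancel₀ _ hα1.ne', Real.rpow_natCast] at h1
  have hf : fPoly α ℓ ε h t = (ε * t + 1) * (ε * t + 1 + α * (ℓ * t) - h * t) := by
    obtain ⟨c, hc⟩ : ∃ c, α * ℓ + ε = h + c := ⟨α * ℓ + ε - h, by omega⟩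
    have h1 : α * ℓ + ε - h = c := by omega
    have h2 : α * ℓ + 2 * ε - h = c + ε := by omega
    have h3 : ε * t + 1 + α * (ℓ * t) - h * t = c * t + 1 := by
      have : (α * ℓ + ε) * t = (h + c) * t := by rw [hc]
      have e1 : (α * ℓ + ε) * t = α * (ℓ * t) + ε * t := by ring
      have e2 : (h + c) * t = h * t + c * t := by ring
      omega
    rw [fPoly, h1, h2, h3]
    ring
  have hM : h * t ≤ ε * t + 1 + α * (ℓ * t) := by
    have := Nat.mul_le_mul_right t hhle
    have e1 : (α * ℓ + ε) * t = α * (ℓ * t) + ε * t := by ring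
    omega
  obtain ⟨A, hA⟩ := exists_forall_not_bad_s19 (ι := Fin r)
    (X := Matrix (Fin (ℓ * t)) (Fin (h * t)) (ZMod 2)) (α := α)
    (Bad := fun I f => Module.finrank (ZMod 2)
      ↥(⨆ i ∈ I, LinearMap.range (f i).vecMulLinear) + (ε * t + 1) ≤ h * t)
    (p := 4 / 2 ^ fPoly α ℓ ε h t) (x := 1 - 1 / (α : ℝ))
    (fun I f g hfg hf => by
      have : (⨆ i ∈ I, LinearMap.range (g i).vecMulLinear) =
          ⨆ i ∈ I, LinearMap.range (f i).vecMulLinear :=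
        iSup_congr fun i => iSup_congr fun hi => by rw [hfg i hi]
      rw [this]
      exact hf) (by omega) (by positivity)
    (by rw [sub_pos, div_lt_one hα0]; linarith)
    (fun I hI => by
      have := card_filter_finrank_add_le (K := ZMod 2) (r := r) (L := ℓ * t) (M := h * t)
        (s := ε * t + 1) I (by omega) (by rw [hI]; exact hM)
      rw [hI, ← hf, ZMod.card] at this
      rw [div_mul_eq_mul_div, le_div_iff₀ (by positivity)]
      norm_cast
      convert this)
    (by
      have hx := inv_exp_one_le_one_sub_inv_pow hα
      have hch : ((r.choose (α - 1) : ℕ) : ℝ) ≤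
          2 ^ fPoly α ℓ ε h t / (2 * Real.exp 1 * 4 * α) := by
        refine (Nat.choose_le_pow_div (α := ℝ) _ _).trans ?_
        rw [div_le_iff₀ hfac]
        refine hrpow.trans_eq ?_
        ring
      have hnum : (r.choose (α - 1) : ℝ) * (4 / 2 ^ fPoly α ℓ ε h t) ≤
          1 / α * (Real.exp 1)⁻¹ := by
        refine (mul_le_mul_of_nonneg_right hch (by positivity)).trans ?_
        have he : 2 ^ fPoly α ℓ ε h t / (2 * Real.exp 1 * 4 * α) *
          (4 / 2 ^ fPoly α ℓ ε h t) = 1 / 2 * (1 / α * (Real.exp 1)⁻¹) := by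
          field_simp
        rw [he]
        have : 0 ≤ 1 / (α : ℝ) * (Real.exp 1)⁻¹ := by positivity
        linarith
      have hpos : 0 < (1 - 1 / (α : ℝ)) ^ (α - 1) := lt_of_lt_of_le (by positivity) hx
      rw [Fintype.card_fin]
      have : (r.choose (α - 1) : ℝ) * (4 / 2 ^ fPoly α ℓ ε h t) /
          (1 - 1 / (α : ℝ)) ^ (α - 1) ≤ 1 / α := by
        rw [div_le_iff₀ hpos]
        exact hnum.trans (mul_le_mul_of_nonneg_left hx (by positivity))
      linarith)
  refine ⟨ZMod 2, inferInstance, inferInstance, ZMod.card 2, A, fun I hI => ?_⟩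
  have h1 := hA I hI
  have h2 : (h - ε) * t + ε * t = h * t := by rw [← add_mul, Nat.sub_add_cancel hh.le]
  omega

theorem gap_lower_bound (α ℓ ε h r qs tΔ : ℕ)
    (hα : 2 ≤ α) (hℓ : 1 ≤ ℓ) (hε : 1 ≤ ε)
    (hh : 2 * ℓ + ε < h) (hhle : h ≤ α * ℓ + ε)
    (hrθ : 4 * ((thetaVal α h ℓ ε : ℝ)) < (r : ℝ) + (thetaVal α h ℓ ε : ℝ) - α)
    (htΔ1 : 1 ≤ tΔ)
    (htΔ : (r : ℝ) / betaConst α ≤ (2 : ℝ) ^ ((fPoly α ℓ ε h tΔ : ℝ) / ((α : ℝ) - 1)))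
    (htΔmin : ∀ t' : ℕ, 1 ≤ t' → t' < tΔ →
      ¬((r : ℝ) / betaConst α ≤ (2 : ℝ) ^ ((fPoly α ℓ ε h t' : ℝ) / ((α : ℝ) - 1))))
    (hqs : IsPrimePow qs) (hsol : HasLinearSol α h ℓ ε r qs 1) :
    (((r : ℝ) + (thetaVal α h ℓ ε : ℝ) - α) / (4 * (thetaVal α h ℓ ε : ℝ))) ^
        ((1 : ℝ) / (ℓ * (ε + 1))) ≤ (qs : ℝ) ∧
    HasLinearSol α h ℓ ε r 2 tΔ ∧
    Real.logb 2 qs - tΔ ≥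
      (1 / ((ℓ : ℝ) * (ε + 1))) *
        Real.logb 2 (((r : ℝ) + (thetaVal α h ℓ ε : ℝ) - α) / (4 * (thetaVal α h ℓ ε : ℝ))) -
      tΔ := by

  have hθ : (1 : ℝ) ≤ thetaVal α h ℓ ε := by
    have : 1 ≤ thetaVal α h ℓ ε := Nat.le_add_left _ _
    exact_mod_cast this
  have hscalar := scalar_solution_bound hℓ hh hhle hrθ hsol
  set B : ℝ := ((r : ℝ) + (thetaVal α h ℓ ε : ℝ) - α) / (4 * (thetaVal α h ℓ ε : ℝ)) with hB
  have hB0 : 0 < B := div_pos (by linarith) (by linarith)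
  have hBq : B ≤ (qs : ℝ) ^ (ℓ * (ε + 1)) := by
    rw [hB, div_le_iff₀ (by linarith)]
    linarith
  have hn : (0 : ℝ) < (ℓ : ℝ) * (ε + 1) := by positivity
  have hroot : B ^ ((1 : ℝ) / (ℓ * (ε + 1))) ≤ (qs : ℝ) := by
    rw [one_div, Real.rpow_inv_le_iff_of_pos hB0.le (Nat.cast_nonneg _) hn]
    refine hBq.trans_eq ?_
    rw [← Real.rpow_natCast]
    push_cast
    rfl
  refine ⟨hroot, hasLinearSol_two_of_le hα (by omega) hhle htΔ, ?_⟩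
  have hlog := Real.logb_le_logb_of_le (b := 2) (by norm_num) (by positivity) hroot
  rw [Real.logb_rpow_eq_mul_logb_of_pos hB0] at hlog
  linarith
end
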